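/- arXiv:2301.07555 — 6 statements merged into one kernel-verified Lean document; each statement's English description precedes it below -/
import Mathlib

section
/- Let Ω be a set, a₁, …, a_M : Ω → ℝ functions, and V ⊆ Ω. Let f : ℝ^M → ℝ ∪ {+∞} be convex, lower semicontinuous and proper. Suppose there exist finitely many points x₁, …, x_n ∈ V and reals α₁, …, α_n such that the vector b ∈ ℝ^M with coordinates b_m = Σ_{i=1}^n α_i a_m(x_i) lies in the interior of the domain of f. Let C = {q ∈ ℝ^M : |Σ_{m=1}^M q_m a_m(x)| ≤ 1 for all x ∈ V}. Then the convex conjugate f* is coercive on C: for every sequence (q_j) in C with ‖q_j‖₂ → ∞, one has f*(q_j) → +∞. -/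
open Filter

/-- Coercivity of the convex conjugate `f*` on the dual-feasible set
`C = {q : |∑ m, q m * a m x| ≤ 1 on V}`, assuming the interior of the domain of `f`
is reached by a measure supported on finitely many points of `V`. -/
theorem conjugate_coercive_on_feasible_set {Ω : Type*} (M : ℕ)
    (a : Fin M → Ω → ℝ) (V : Set Ω)
    (f : EuclideanSpace ℝ (Fin M) → EReal)
    (hconv : ∀ x y : EuclideanSpace ℝ (Fin M), ∀ t : ℝ, 0 ≤ t → t ≤ 1 →
      f (t • x + (1 - t) • y) ≤ (t : ℝ) * f x + ((1 - t : ℝ) : EReal) * f y)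
    (hlsc : LowerSemicontinuous f)
    (hbot : ∀ b, f b ≠ ⊥)
    (n : ℕ) (x : Fin n → Ω) (hx : ∀ i, x i ∈ V) (α : Fin n → ℝ)
    (b : EuclideanSpace ℝ (Fin M))
    (hb : ∀ m, b m = ∑ i, α i * a m (x i))
    (hbint : b ∈ interior {b' | f b' ≠ ⊤})
    (q : ℕ → EuclideanSpace ℝ (Fin M))
    (hq : ∀ j, ∀ z ∈ V, |∑ m, q j m * a m z| ≤ 1)
    (hnorm : Tendsto (fun j => ‖q j‖) atTop atTop) :
    Tendsto (fun j => ⨆ b' : EuclideanSpace ℝ (Fin M),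
      (((∑ m, q j m * b' m : ℝ) : EReal) - f b')) atTop (nhds ⊤) := by
  obtain ⟨r, hr, hball⟩ := Metric.isOpen_iff.1 isOpen_interior b hbint
  set s : ℝ := r / 2 with hs
  have hs0 : 0 < s := by positivity
  let p : Fin M → ℝ → EuclideanSpace ℝ (Fin M) := fun m σ =>
    b + EuclideanSpace.single m (σ * s)
  have hp : ∀ m σ, |σ| = 1 → f (p m σ) = ((f (p m σ)).toReal : EReal) := by
    intro m σ hσ
    have h1 : p m σ ∈ Metric.ball b r := by
      rw [Metric.mem_ball, dist_eq_norm]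
      simp only [p, add_sub_cancel_left, EuclideanSpace.norm_single, Real.norm_eq_abs, abs_mul, hσ,
        one_mul, abs_of_pos hs0]
      linarith
    have h2 : f (p m σ) ≠ ⊤ := interior_subset (hball h1)
    exact (EReal.coe_toReal h2 (hbot _)).symm
  set K : ℝ := ∑ m, (|(f (p m 1)).toReal| + |(f (p m (-1))).toReal|) with hK
  have hKle : ∀ m, |(f (p m 1)).toReal| + |(f (p m (-1))).toReal| ≤ K := fun m =>
    Finset.single_le_sum (f := fun m => |(f (p m 1)).toReal| + |(f (p m (-1))).toReal|)
      (fun i _ => by positivity) (Finset.mem_univ m)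
  set A : ℝ := ∑ i, |α i| with hA
  have hqb : ∀ j, -A ≤ ∑ m, q j m * b m := by
    intro j
    have h1 : ∑ m, q j m * b m = ∑ i, α i * ∑ m, q j m * a m (x i) := by
      simp only [hb, Finset.mul_sum]
      rw [Finset.sum_comm]
      refine Finset.sum_congr rfl fun i _ => Finset.sum_congr rfl fun m _ => by ring
    have h2 : |∑ m, q j m * b m| ≤ A := by
      rw [h1]
      refine (Finset.abs_sum_le_sum_abs _ _).trans (Finset.sum_le_sum fun i _ => ?_)
      rw [abs_mul]
      exact mul_le_of_le_one_right (abs_nonneg _) (hq j _ (hx i))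
    exact (abs_le.1 h2).1
  have hn : ∀ v : EuclideanSpace ℝ (Fin M), ‖v‖ ≤ ∑ m, |v m| := by
    intro v
    have h : v = ∑ m, EuclideanSpace.single m (v m) := by
      ext i
      simp [Pi.single_apply]
    calc ‖v‖ = ‖∑ m, EuclideanSpace.single m (v m)‖ := by rw [← h]
      _ ≤ ∑ m, ‖EuclideanSpace.single m (v m)‖ := norm_sum_le _ _
      _ = ∑ m, |v m| := by simp
  rw [EReal.tendsto_nhds_top_iff_real]
  intro T
  filter_upwards [hnorm.eventually_gt_atTop (∑ _m : Fin M, (T + A + K) / s)] with j hj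
  obtain ⟨m, -, hm⟩ := Finset.exists_lt_of_sum_lt (hj.trans_le (hn (q j)))
  rw [div_lt_iff₀ hs0] at hm
  have key : ∃ σ : ℝ, |σ| = 1 ∧ q j m * σ = |q j m| ∧ (f (p m σ)).toReal ≤ K := by
    have hk := hKle m
    rcases le_total 0 (q j m) with h | h
    · refine ⟨1, by simp, by rw [abs_of_nonneg h, mul_one], ?_⟩
      linarith [le_abs_self (f (p m 1)).toReal, abs_nonneg (f (p m (-1))).toReal]
    · refine ⟨-1, by simp, by rw [abs_of_nonpos h]; ring, ?_⟩
      linarith [le_abs_self (f (p m (-1))).toReal, abs_nonneg (f (p m 1)).toReal]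
  obtain ⟨σ, hσ, hσq, hσK⟩ := key
  refine lt_of_lt_of_le ?_ (le_iSup _ (p m σ))
  rw [hp m σ hσ, ← EReal.coe_sub, EReal.coe_lt_coe_iff]
  have h3 : ∑ k, q j k * (p m σ) k = ∑ k, q j k * b k + |q j m| * s := by
    simp only [p, PiLp.add_apply, mul_add, Finset.sum_add_distrib]
    congr 1
    rw [← hσq]
    simp [Pi.single_apply, mul_assoc]
  rw [h3]
  linarith [hqb j]
end

section
/- Let Ω be a compact metric space, a₁, …, a_M : Ω → ℝ continuous, and for a finite signed Borel measure ν on Ω set Aν := (∫ a_1 dν, …, ∫ a_M dν) ∈ ℝ^M. Let f : ℝ^M → ℝ ∪ {+∞} be lower semicontinuous and let f* be its convex conjugate. Suppose (μ_k) is a sequence of finite signed Borel measures with ∫ g dμ_k → ∫ g dμ_∞ for every continuous g : Ω → ℝ, and (q_k) is a sequence in ℝ^M converging to q_∞. If for every k the exact duality relation f*(q_k) + f(Aμ_k) = −|μ_k|(Ω) holds (with both f*(q_k) and f(Aμ_k) finite), then |μ_∞|(Ω) + f(Aμ_∞) ≤ −f*(q_∞). -/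
open MeasureTheory Filter

/-- The integral of `g` against a finite signed Borel measure `μ`, defined via the
Jordan decomposition `μ = μ⁺ − μ⁻` as `∫ g dμ⁺ − ∫ g dμ⁻`. -/
noncomputable def signedIntegral {Ω : Type*} [MeasurableSpace Ω]
    (μ : SignedMeasure Ω) (g : Ω → ℝ) : ℝ :=
  ∫ x, g x ∂μ.toJordanDecomposition.posPart - ∫ x, g x ∂μ.toJordanDecomposition.negPart

theorem aux_lower {Ω : Type*} [MetricSpace Ω] [CompactSpace Ω] [MeasurableSpace Ω] [BorelSpace Ω]
    (ν : Measure Ω) [IsFiniteMeasure ν] (K : Set Ω) (hK : IsClosed K) (g : Ω → ℝ)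
    (hg : Continuous g) (h1 : ∀ x, -1 ≤ g x) (hgK : ∀ x ∈ K, g x = 1) :
    ν.real Set.univ - 2 * ν.real Kᶜ ≤ ∫ x, g x ∂ν := by
  have hgi : Integrable g ν := hg.integrable_of_hasCompactSupport (HasCompactSupport.of_compactSpace g)
  have hm : MeasurableSet Kᶜ := hK.measurableSet.compl
  have hi : Integrable (Kᶜ.indicator (fun _ => (2 : ℝ))) ν := (integrable_const _).indicator hm
  have e : ν.real Set.univ - 2 * ν.real Kᶜ = ∫ x, (1 - Kᶜ.indicator (fun _ => (2 : ℝ)) x) ∂ν := by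
    rw [integral_sub (integrable_const _) hi, integral_indicator hm]
    simp [mul_comm]
  rw [e]
  refine integral_mono ((integrable_const _).sub hi) hgi ?_
  intro x
  by_cases hx : x ∈ K
  · simp [hx, hgK x hx]
  · have := h1 x
    simp [hx]
    linarith

theorem aux_closed {Ω : Type*} [MetricSpace Ω] [MeasurableSpace Ω] [BorelSpace Ω]
    (ν : Measure Ω) [IsFiniteMeasure ν] (s : Set Ω) (hs : MeasurableSet s) (h0 : ν sᶜ = 0)
    (ε : ℝ) (hε : 0 < ε) : ∃ K ⊆ s, IsClosed K ∧ ν.real Kᶜ ≤ ε := by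
  obtain ⟨K, hKs, hK, hlt⟩ := hs.exists_isClosed_sdiff_lt (μ := ν) (measure_ne_top _ _)
    (ε := ENNReal.ofReal ε) (by simpa using hε)
  refine ⟨K, hKs, hK, ENNReal.toReal_le_of_le_ofReal hε.le ?_⟩
  calc ν Kᶜ ≤ ν (sᶜ ∪ s \ K) := measure_mono (by
        intro x hx
        by_cases h : x ∈ s
        · exact Or.inr ⟨h, hx⟩
        · exact Or.inl h)
    _ ≤ ν sᶜ + ν (s \ K) := measure_union_le _ _
    _ ≤ ENNReal.ofReal ε := by rw [h0, zero_add]; exact hlt.le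

theorem aux_tv {Ω : Type*} [MeasurableSpace Ω] (μ : SignedMeasure Ω) :
    (μ.totalVariation Set.univ).toReal = μ.toJordanDecomposition.posPart.real Set.univ
      + μ.toJordanDecomposition.negPart.real Set.univ := by
  rw [SignedMeasure.totalVariation, Measure.add_apply,
    ENNReal.toReal_add (measure_ne_top _ _) (measure_ne_top _ _)]
  rfl

theorem aux_upper {Ω : Type*} [MetricSpace Ω] [CompactSpace Ω] [MeasurableSpace Ω] [BorelSpace Ω]
    (μ : SignedMeasure Ω) (g : Ω → ℝ) (hg : Continuous g) (h : ∀ x, g x ∈ Set.Icc (-1 : ℝ) 1) :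
    signedIntegral μ g ≤ (μ.totalVariation Set.univ).toReal := by
  rw [aux_tv, signedIntegral]
  have hgi : ∀ (ν : Measure Ω) [IsFiniteMeasure ν], Integrable g ν := fun ν _ =>
    hg.integrable_of_hasCompactSupport (HasCompactSupport.of_compactSpace g)
  have a1 := integral_mono (hgi μ.toJordanDecomposition.posPart) (integrable_const (1 : ℝ))
    (fun x => (h x).2)
  have a2 := integral_mono (integrable_const (-1 : ℝ)) (hgi μ.toJordanDecomposition.negPart)
    (fun x => (h x).1)
  simp at a1 a2
  linarith

theorem aux_approx {Ω : Type*} [MetricSpace Ω] [CompactSpace Ω] [MeasurableSpace Ω] [BorelSpace Ω]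
    (μ : SignedMeasure Ω) (ε : ℝ) (hε : 0 < ε) : ∃ g : Ω → ℝ, Continuous g ∧
      (∀ x, g x ∈ Set.Icc (-1 : ℝ) 1) ∧
      (μ.totalVariation Set.univ).toReal ≤ signedIntegral μ g + 4 * ε := by
  obtain ⟨s, hs, h1, h2⟩ := μ.toJordanDecomposition.mutuallySingular
  obtain ⟨K, hKs, hK, hKε⟩ := aux_closed μ.toJordanDecomposition.posPart sᶜ hs.compl
    (by simpa using h1) ε hε
  obtain ⟨L, hLs, hL, hLε⟩ := aux_closed μ.toJordanDecomposition.negPart s hs h2 ε hε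
  obtain ⟨g, g1, g2, g3⟩ := exists_bounded_mem_Icc_of_closed_of_le hL hK
    (Set.disjoint_of_subset hLs hKs disjoint_compl_right) (show (-1 : ℝ) ≤ 1 by norm_num)
  refine ⟨g, g.continuous, g3, ?_⟩
  have b1 := aux_lower μ.toJordanDecomposition.posPart K hK g g.continuous
    (fun x => (g3 x).1) (fun x hx => g2 hx)
  have b2 := aux_lower μ.toJordanDecomposition.negPart L hL (fun x => - g x) g.continuous.neg
    (fun x => neg_le_neg (g3 x).2) (fun x hx => by simp [g1 hx])
  rw [integral_neg] at b2
  rw [aux_tv, signedIntegral]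
  linarith

/-- Passing exact duality relations `f*(q_k) + f(Aμ_k) = −|μ_k|(Ω)` to the limit:
if `μ_k → μ_∞` weakly-* and `q_k → q_∞`, then `|μ_∞|(Ω) + f(Aμ_∞) ≤ −f*(q_∞)`. -/
theorem limit_duality_inequality
    {Ω : Type*} [MetricSpace Ω] [CompactSpace Ω] [MeasurableSpace Ω] [BorelSpace Ω]
    (M : ℕ) (a : Fin M → Ω → ℝ) (ha : ∀ m, Continuous (a m))
    (f : (Fin M → ℝ) → EReal) (hlsc : LowerSemicontinuous f)
    (A : SignedMeasure Ω → Fin M → ℝ)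
    (hA : ∀ ν m, A ν m = signedIntegral ν (a m))
    (fstar : (Fin M → ℝ) → EReal)
    (hfstar : ∀ q, fstar q = ⨆ b : Fin M → ℝ, (((∑ m, q m * b m : ℝ) : EReal) - f b))
    (μk : ℕ → SignedMeasure Ω) (μlim : SignedMeasure Ω)
    (hμ : ∀ g : Ω → ℝ, Continuous g →
      Tendsto (fun k => signedIntegral (μk k) g) atTop (nhds (signedIntegral μlim g)))
    (qk : ℕ → Fin M → ℝ) (qlim : Fin M → ℝ) (hq : Tendsto qk atTop (nhds qlim))
    (hfin1 : ∀ k, fstar (qk k) ≠ ⊤ ∧ fstar (qk k) ≠ ⊥)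
    (hfin2 : ∀ k, f (A (μk k)) ≠ ⊤ ∧ f (A (μk k)) ≠ ⊥)
    (hdual : ∀ k, fstar (qk k) + f (A (μk k)) =
      ((-(((μk k).totalVariation Set.univ).toReal) : ℝ) : EReal)) :
    (((μlim.totalVariation Set.univ).toReal : ℝ) : EReal) + f (A μlim) ≤ -fstar qlim := by
  have hnb : ∀ b, f b ≠ ⊥ := by
    intro b hb
    apply (hfin1 0).1
    rw [hfstar, eq_top_iff]
    refine le_trans ?_ (le_iSup _ b)
    simp [hb]
  have hAt : Tendsto (fun k => A (μk k)) atTop (nhds (A μlim)) := by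
    rw [tendsto_pi_nhds]
    intro m
    simp only [hA]
    exact hμ _ (ha m)
  rw [EReal.le_neg, hfstar]
  refine iSup_le fun b => ?_
  by_cases hbt : f b = ⊤
  · simp [hbt]
  lift f b to ℝ using ⟨hbt, hnb b⟩ with r hr
  have key : ∀ g : Ω → ℝ, Continuous g → (∀ x, g x ∈ Set.Icc (-1 : ℝ) 1) →
      f (A μlim) ≤ ((-signedIntegral μlim g - ∑ m, qlim m * b m + r : ℝ) : EReal) := by
    intro g hg hg1
    have hlim : Tendsto (fun k => ((-signedIntegral (μk k) g - ∑ m, qk k m * b m + r : ℝ) : EReal))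
        atTop (nhds ((-signedIntegral μlim g - ∑ m, qlim m * b m + r : ℝ) : EReal)) := by
      refine (continuous_coe_real_ereal.tendsto _).comp ?_
      refine (((hμ g hg).neg).sub (tendsto_finsetSum _ fun m _ => ?_)).add_const r
      exact ((tendsto_pi_nhds.1 hq) m).mul_const _
    have hle : ∀ k, f (A (μk k)) ≤
        ((-signedIntegral (μk k) g - ∑ m, qk k m * b m + r : ℝ) : EReal) := by
      intro k
      have h1 : ((∑ m, qk k m * b m : ℝ) : EReal) - (r : EReal) ≤ fstar (qk k) := by
        rw [hfstar, hr]
        exact le_iSup (fun b : Fin M → ℝ => ((∑ m, qk k m * b m : ℝ) : EReal) - f b) b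
      have h2 := hdual k
      have h3 := aux_upper (μk k) g hg hg1
      have f1 := hfin1 k
      have f2 := hfin2 k
      lift fstar (qk k) to ℝ using f1 with u
      lift f (A (μk k)) to ℝ using f2 with v
      norm_cast at h1 h2 ⊢
      linarith
    by_contra hcon
    push Not at hcon
    obtain ⟨d, hd1, hd2⟩ := exists_between hcon
    have e1 := hAt.eventually (hlsc (A μlim) d hd2)
    have e2 := hlim.eventually (gt_mem_nhds hd1)
    obtain ⟨k, k1, k2⟩ := (e1.and e2).exists
    exact absurd (hle k) (not_le.2 (k2.trans k1))
  have hft : f (A μlim) ≠ ⊤ := by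
    have := key (fun _ => 0) continuous_const (by intro x; simp)
    exact ne_top_of_le_ne_top (EReal.coe_ne_top _) this
  have hfb := hnb (A μlim)
  lift f (A μlim) to ℝ using ⟨hft, hfb⟩ with v
  norm_cast
  refine le_of_forall_pos_le_add fun ε hε => ?_
  obtain ⟨g, g1, g2, g3⟩ := aux_approx μlim (ε / 4) (by positivity)
  have := key g g1 g2
  norm_cast at this
  linarith
end

section
/- Let ω ⊂ ℝ^D be a nonempty compact convex set and let g : ℝ^D → ℝ be differentiable with ∇g κ-Lipschitz on ω, i.e., ‖∇g(x) − ∇g(y)‖₂ ≤ κ ‖x − y‖₂ for all x, y ∈ ω. For v ∈ ω define T(v) := sup_{x ∈ ω} ( |g(v) + ⟨∇g(v), x − v⟩| + (κ/2)‖x − v‖₂² ). Then for every v ∈ ω the two-sided bound T(v) − κ · diam(ω)² ≤ sup_{x ∈ ω} |g(x)| ≤ T(v) holds, where diam(ω) = sup_{x, y ∈ ω} ‖x − y‖₂. -/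
open scoped RealInnerProductSpace

theorem taylor_aux {E : Type*} [NormedAddCommGroup E] [InnerProductSpace ℝ E] [CompleteSpace E]
    (ω : Set E) (hconv : Convex ℝ ω) (g : E → ℝ) (hdiff : Differentiable ℝ g) (κ : ℝ)
    (hlip : ∀ x ∈ ω, ∀ y ∈ ω, ‖gradient g x - gradient g y‖ ≤ κ * ‖x - y‖)
    (v x : E) (hv : v ∈ ω) (hx : x ∈ ω) :
    |g x - g v - ⟪gradient g v, x - v⟫| ≤ κ / 2 * ‖x - v‖ ^ 2 := by
  have hd : ∀ t : ℝ, HasDerivAt (fun t : ℝ => g (v + t • (x - v)) - g v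
      - t * ⟪gradient g v, x - v⟫)
      (⟪gradient g (v + t • (x - v)) - gradient g v, x - v⟫) t := by
    intro t
    have h1 : HasDerivAt (fun t : ℝ => v + t • (x - v)) (x - v) t := by
      simpa using ((hasDerivAt_id t).smul_const (x - v)).const_add v
    have h2 := ((hdiff (v + t • (x - v))).hasGradientAt.hasFDerivAt).comp_hasDerivAt t h1
    have h3 := (h2.sub_const (g v)).sub ((hasDerivAt_id t).mul_const ⟪gradient g v, x - v⟫)
    refine h3.congr_deriv ?_
    simp [inner_sub_left]
  have hB : ∀ t : ℝ, HasDerivAt (fun t : ℝ => κ / 2 * ‖x - v‖ ^ 2 * t ^ 2)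
      (κ * ‖x - v‖ ^ 2 * t) t := by
    intro t
    refine ((hasDerivAt_pow 2 t).const_mul (κ / 2 * ‖x - v‖ ^ 2)).congr_deriv ?_
    norm_num
    ring
  have key := image_norm_le_of_norm_deriv_right_le_deriv_boundary (a := 0) (b := 1)
    (fun t _ => (hd t).continuousAt.continuousWithinAt)
    (fun t _ => (hd t).hasDerivWithinAt) (by simp) hB ?_ (x := 1) (by simp)
  · simpa using key
  · intro t ht
    have hm : v + t • (x - v) ∈ ω := hconv.add_smul_sub_mem hv hx ⟨ht.1, ht.2.le⟩
    have h1 := hlip _ hm v hv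
    calc _ ≤ ‖gradient g (v + t • (x - v)) - gradient g v‖ * ‖x - v‖ := norm_inner_le_norm _ _
      _ ≤ (κ * ‖v + t • (x - v) - v‖) * ‖x - v‖ := by gcongr
      _ = _ := by
        rw [add_sub_cancel_left, norm_smul, Real.norm_of_nonneg ht.1]; ring

/-- Two-sided second-order bound: with `T(v) = sup_{x ∈ ω} (|g(v) + ⟨∇g(v), x−v⟩| + (κ/2)‖x−v‖²)`,
one has `T(v) − κ·diam(ω)² ≤ sup_{x ∈ ω} |g(x)| ≤ T(v)` for every `v ∈ ω`. -/
theorem second_order_two_sided_bound (D : ℕ) (ω : Set (EuclideanSpace ℝ (Fin D)))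
    (hne : ω.Nonempty) (hcomp : IsCompact ω) (hconv : Convex ℝ ω)
    (g : EuclideanSpace ℝ (Fin D) → ℝ) (hdiff : Differentiable ℝ g)
    (κ : ℝ)
    (hlip : ∀ x ∈ ω, ∀ y ∈ ω, ‖gradient g x - gradient g y‖ ≤ κ * ‖x - y‖) :
    ∀ v ∈ ω, ∀ S T : ℝ,
      IsLUB {r : ℝ | ∃ x ∈ ω, r = |g x|} S →
      IsLUB {r : ℝ | ∃ x ∈ ω,
        r = |g v + ⟪gradient g v, x - v⟫| + κ / 2 * ‖x - v‖ ^ 2} T →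
      T - κ * Metric.diam ω ^ 2 ≤ S ∧ S ≤ T := by
  intro v hv S T hS hT
  have key := fun x hx => abs_le.1 (taylor_aux ω hconv g hdiff κ hlip v x hv hx)
  constructor
  · rw [sub_le_iff_le_add]
    refine hT.2 ?_
    rintro r ⟨x, hx, rfl⟩
    have h1 : |g x| ≤ S := hS.1 ⟨x, hx, rfl⟩
    have hk : κ * ‖x - v‖ ^ 2 ≤ κ * Metric.diam ω ^ 2 := by
      have hdm : ‖x - v‖ ≤ Metric.diam ω := by
        rw [← dist_eq_norm]; exact Metric.dist_le_diam_of_mem hcomp.isBounded hx hv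
      rcases le_or_gt 0 κ with h | h
      · gcongr
      · have hs : ω.Subsingleton := by
          intro a ha b hb
          have h2 := (norm_nonneg _).trans (hlip a ha b hb)
          have h3 : ‖a - b‖ ≤ 0 := by
            by_contra! h4
            nlinarith
          exact sub_eq_zero.1 (norm_le_zero_iff.1 h3)
        rw [Metric.diam_subsingleton hs, hs hx hv]; simp
    have h2 : |g v + ⟪gradient g v, x - v⟫| ≤ |g x| + κ / 2 * ‖x - v‖ ^ 2 := by
      have := key x hx
      rw [abs_le]
      constructor <;> linarith [le_abs_self (g x), neg_abs_le (g x)]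
    linarith
  · refine hS.2 ?_
    rintro r ⟨x, hx, rfl⟩
    refine le_trans ?_ (hT.1 ⟨x, hx, rfl⟩)
    have := key x hx
    rw [abs_le]
    constructor <;> linarith [le_abs_self (g v + ⟪gradient g v, x - v⟫),
      neg_abs_le (g v + ⟪gradient g v, x - v⟫)]
end

section
/- Let D ≥ 1, σ > 0, z ∈ ℝ^D, and a(x) = (1/(2πσ)) exp(−‖x − z‖₂² / (2σ²)). Let ω ⊂ ℝ^D be a nonempty compact set with diam(ω) ≤ √D · ℓ for some ℓ ≥ 0 (e.g., a cube of edge-length ℓ), and set d := dist(z, ω) = inf_{y ∈ ω} ‖z − y‖₂. Then sup_{x ∈ ω} ‖∇²a(x)‖_{2→2} ≤ (1/(2πσ)) exp(−d²/(2σ²)) · σ^{-4} · max(σ², (d + √D · ℓ)²). -/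
open scoped InnerProductSpace in
lemma gauss_bilin {E : Type*} [NormedAddCommGroup E] [InnerProductSpace ℝ E] (w u v : E) (s M : ℝ)
    (hs : 0 ≤ s) (hsM : s ≤ M) (hM : ‖w‖ ^ 2 ≤ M) :
    |⟪w, u⟫_ℝ * ⟪w, v⟫_ℝ - s * ⟪u, v⟫_ℝ| ≤ M * ‖u‖ * ‖v‖ := by
  have e : ⟪w, u⟫_ℝ * ⟪w, v⟫_ℝ - s * ⟪u, v⟫_ℝ = ⟪(⟪w, u⟫_ℝ) • w - s • u, v⟫_ℝ := by
    rw [inner_sub_left, real_inner_smul_left, real_inner_smul_left]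
  rw [e]
  refine (abs_real_inner_le_norm _ _).trans ?_
  refine mul_le_mul_of_nonneg_right ?_ (norm_nonneg _)
  have hM0 : 0 ≤ M := hs.trans hsM
  refine abs_le_of_sq_le_sq' ?_ (by positivity) |>.2
  have h1 : ‖(⟪w, u⟫_ℝ) • w - s • u‖ ^ 2
      = ⟪w, u⟫_ℝ ^ 2 * (‖w‖ ^ 2 - 2 * s) + s ^ 2 * ‖u‖ ^ 2 := by
    rw [norm_sub_sq_real, norm_smul, norm_smul, real_inner_smul_left, real_inner_smul_right,
      mul_pow, mul_pow, Real.norm_eq_abs, Real.norm_eq_abs, sq_abs, sq_abs]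
    ring
  have h2 : ⟪w, u⟫_ℝ ^ 2 ≤ ‖w‖ ^ 2 * ‖u‖ ^ 2 := by
    rw [← mul_pow, ← sq_abs]
    exact pow_le_pow_left₀ (abs_nonneg _) (abs_real_inner_le_norm _ _) 2
  rw [h1, mul_pow]
  have hu : 0 ≤ ‖u‖ ^ 2 := by positivity
  have hw : 0 ≤ ‖w‖ ^ 2 := by positivity
  rcases le_total (‖w‖ ^ 2) (2 * s) with h | h
  · have h3 : ⟪w, u⟫_ℝ ^ 2 * (‖w‖ ^ 2 - 2 * s) ≤ 0 :=
      mul_nonpos_of_nonneg_of_nonpos (sq_nonneg _) (by linarith)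
    have h4 : s ^ 2 ≤ M ^ 2 := pow_le_pow_left₀ hs hsM 2
    nlinarith [mul_le_mul_of_nonneg_right h4 hu]
  · have h3 := mul_le_mul_of_nonneg_right h2 (sub_nonneg.2 h)
    have h4 : (‖w‖ ^ 2 - s) ^ 2 ≤ M ^ 2 := pow_le_pow_left₀ (by linarith) (by linarith) 2
    nlinarith [mul_le_mul_of_nonneg_right h4 hu]

/-- Hessian bound for a Gaussian over a cell `ω` with `diam(ω) ≤ √D·ℓ`, in terms of the
distance `d = dist(z, ω)`: `sup_{x∈ω} ‖∇²a(x)‖ ≤ (1/(2πσ)) e^{−d²/(2σ²)} σ^{−4}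
max(σ², (d + √D·ℓ)²)`. -/
theorem gaussian_hessian_bound_on_cell (D : ℕ) (hD : 1 ≤ D) (σ : ℝ) (hσ : 0 < σ)
    (z : EuclideanSpace ℝ (Fin D))
    (a : EuclideanSpace ℝ (Fin D) → ℝ)
    (ha : ∀ x, a x = (1 / (2 * Real.pi * σ)) * Real.exp (-‖x - z‖ ^ 2 / (2 * σ ^ 2)))
    (ω : Set (EuclideanSpace ℝ (Fin D))) (hne : ω.Nonempty) (hcomp : IsCompact ω)
    (ℓ : ℝ) (hℓ : 0 ≤ ℓ) (hdiam : Metric.diam ω ≤ Real.sqrt D * ℓ)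
    (d : ℝ) (hd : d = Metric.infDist z ω) :
    ∀ x ∈ ω, ‖iteratedFDeriv ℝ 2 a x‖ ≤
      1 / (2 * Real.pi * σ) * Real.exp (-d ^ 2 / (2 * σ ^ 2)) / σ ^ 4 *
        max (σ ^ 2) ((d + Real.sqrt D * ℓ) ^ 2) := by
  intro x hx
  have hσ0 : σ ≠ 0 := hσ.ne'
  have hder : ∀ y, HasFDerivAt a ((-(a y) / σ ^ 2) • innerSL ℝ (y - z)) y := by
    intro y
    have h1 : HasFDerivAt (fun y => ‖y - z‖ ^ 2) (2 • (innerSL ℝ (y - z))) y := by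
      simpa using ((hasFDerivAt_id y).sub_const z).norm_sq
    have h2 := ((h1.neg.mul_const ((2 * σ ^ 2)⁻¹)).exp).const_mul (1 / (2 * Real.pi * σ))
    have hf : a = fun x => (1 / (2 * Real.pi * σ)) * Real.exp (-‖x - z‖ ^ 2 * (2 * σ ^ 2)⁻¹) := by
      funext x; rw [ha x, div_eq_mul_inv (-‖x - z‖ ^ 2)]
    rw [hf]
    refine h2.congr_fderiv ?_
    ext v
    simp
    field_simp
  have hfd : fderiv ℝ a = fun y => (-(a y) / σ ^ 2) • innerSL ℝ (y - z) :=
    funext fun y => (hder y).fderiv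
  have hval : ∀ u v, fderiv ℝ (fderiv ℝ a) x u v
      = a x / σ ^ 4 * (inner ℝ (x - z) u * inner ℝ (x - z) v - σ ^ 2 * inner ℝ u v) := by
    intro u v
    have h1 : HasFDerivAt (fun y => -(a y) / σ ^ 2)
        ((σ ^ 2)⁻¹ • (-((-(a x) / σ ^ 2) • innerSL ℝ (x - z)))) x := by
      simpa [div_eq_mul_inv] using ((hder x).neg.mul_const ((σ ^ 2)⁻¹))
    let L : EuclideanSpace ℝ (Fin D) →L[ℝ] EuclideanSpace ℝ (Fin D) →L[ℝ] ℝ := innerSL ℝ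
    have hL : ∀ p q, L p q = inner ℝ p q := fun p q => rfl
    have h2 : HasFDerivAt (fun y => innerSL ℝ (y - z)) L x := by
      have h0 := (L.hasFDerivAt (x := x - z)).comp x ((hasFDerivAt_id x).sub_const z)
      exact h0
    have h3 := (h1.smul h2).fderiv
    have h4 := (congrArg (fun f => fderiv ℝ f x) hfd).trans h3
    beta_reduce at h4
    rw [h4]
    simp [hL, -map_sub, -inner_sub_left]
    field_simp
    ring
  have hdx : d ≤ ‖x - z‖ := by
    rw [hd, ← dist_eq_norm, dist_comm]; exact Metric.infDist_le_dist_of_mem hx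
  have hd0 : 0 ≤ d := hd ▸ Metric.infDist_nonneg
  have hxd : ‖x - z‖ ≤ d + Real.sqrt D * ℓ := by
    obtain ⟨y, hy, hyd⟩ := hcomp.exists_infDist_eq_dist hne z
    have h1 := Metric.dist_le_diam_of_mem hcomp.isBounded hx hy
    have h2 := dist_triangle x y z
    rw [← dist_eq_norm, hd, hyd, dist_comm z y]
    linarith
  set M := max (σ ^ 2) ((d + Real.sqrt D * ℓ) ^ 2) with hMdef
  have hM0 : 0 ≤ M := (sq_nonneg σ).trans (le_max_left _ _)
  have hMr : ‖x - z‖ ^ 2 ≤ M :=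
    (pow_le_pow_left₀ (norm_nonneg _) hxd 2).trans (le_max_right _ _)
  have hax : a x ≤ 1 / (2 * Real.pi * σ) * Real.exp (-d ^ 2 / (2 * σ ^ 2)) := by
    rw [ha x]
    have := pow_le_pow_left₀ hd0 hdx 2
    gcongr
  have hax0 : 0 ≤ a x := by rw [ha x]; positivity
  refine ContinuousMultilinearMap.opNorm_le_bound (by positivity) fun m => ?_
  rw [iteratedFDeriv_two_apply, hval, Fin.prod_univ_two, norm_mul, Real.norm_eq_abs,
    Real.norm_eq_abs, abs_of_nonneg (by positivity : 0 ≤ a x / σ ^ 4)]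
  have hb := gauss_bilin (x - z) (m 0) (m 1) (σ ^ 2) M (sq_nonneg _) (le_max_left _ _) hMr
  calc _ ≤ a x / σ ^ 4 * (M * ‖m 0‖ * ‖m 1‖) := by gcongr
    _ ≤ 1 / (2 * Real.pi * σ) * Real.exp (-d ^ 2 / (2 * σ ^ 2)) / σ ^ 4 * (M * ‖m 0‖ * ‖m 1‖) := by
      gcongr
    _ = _ := by ring
end

section
/- Let D ≥ 1 and c > 0. There exist constants c₀, c₁ > 0 depending only on D and c with the following property: for every x⋆ ∈ ℝ^D, every ℓ ∈ (0,1], and every finite family Ω' of pairwise non-overlapping dyadic cells of [0,1]^D such that each cell ω ∈ Ω' satisfies |ω| ≥ max(ℓ, c·‖x − x⋆‖₂) for every x ∈ ω, the cardinality of Ω' satisfies #Ω' ≤ c₀ + c₁ · log₂(1/ℓ). -/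
/-- The dyadic cell of `[0,1]^D` with edge-length `2^{-J}` and lower corner
`(k i / 2^J)_i`, where `k i < 2^J`. -/
def dyadicCell (D J : ℕ) (k : Fin D → ℕ) : Set (EuclideanSpace ℝ (Fin D)) :=
  {y | ∀ i, (k i : ℝ) / 2 ^ J ≤ y i ∧ y i ≤ ((k i : ℝ) + 1) / 2 ^ J}

theorem dyadicCell_volume_pos (D J : ℕ) (k : Fin D → ℕ) :
    0 < MeasureTheory.volume (dyadicCell D J k) := by
  have ho : IsOpen {y : EuclideanSpace ℝ (Fin D) |
      ∀ i, (k i : ℝ) / 2 ^ J < y i ∧ y i < ((k i : ℝ) + 1) / 2 ^ J} := by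
    simp only [Set.ofPred_forall]
    refine isOpen_iInter_of_finite fun i => ?_
    have hy : Continuous fun y : EuclideanSpace ℝ (Fin D) => y i := by fun_prop
    exact (isOpen_lt continuous_const hy).inter (isOpen_lt hy continuous_const)
  have hne : {y : EuclideanSpace ℝ (Fin D) |
      ∀ i, (k i : ℝ) / 2 ^ J < y i ∧ y i < ((k i : ℝ) + 1) / 2 ^ J}.Nonempty := by
    refine ⟨WithLp.toLp 2 (fun i => ((k i : ℝ) + 1 / 2) / 2 ^ J), fun i => ⟨?_, ?_⟩⟩
    · exact div_lt_div_of_pos_right (by linarith) (by positivity)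
    · exact div_lt_div_of_pos_right (by linarith) (by positivity)
  refine lt_of_lt_of_le (ho.measure_pos MeasureTheory.volume hne) (MeasureTheory.measure_mono ?_)
  intro y hy i
  exact ⟨(hy i).1.le, (hy i).2.le⟩

/-- Counting cells around a single point: there are constants `c₀, c₁ > 0` depending
only on `D` and `c` such that any finite family of pairwise non-overlapping dyadic
cells of `[0,1]^D`, each satisfying `|ω| ≥ max(ℓ, c·‖x − x⋆‖)` for all `x ∈ ω`, has at
most `c₀ + c₁·log₂(1/ℓ)` elements. -/
theorem card_cells_around_point_le (D : ℕ) (hD : 1 ≤ D) (c : ℝ) (hc : 0 < c) :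
    ∃ c₀ c₁ : ℝ, 0 < c₀ ∧ 0 < c₁ ∧
      ∀ (xstar : EuclideanSpace ℝ (Fin D)) (ℓ : ℝ), 0 < ℓ → ℓ ≤ 1 →
      ∀ (n : ℕ) (Js : Fin n → ℕ) (ks : Fin n → Fin D → ℕ),
        (∀ i j, ks i j < 2 ^ Js i) →
        (∀ i i', i ≠ i' →
          MeasureTheory.volume
            (dyadicCell D (Js i) (ks i) ∩ dyadicCell D (Js i') (ks i')) = 0) →
        (∀ i, ∀ x ∈ dyadicCell D (Js i) (ks i),
          max ℓ (c * ‖x - xstar‖) ≤ (2 : ℝ) ^ (-(Js i : ℤ))) →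
        (n : ℝ) ≤ c₀ + c₁ * Real.logb 2 (1 / ℓ) := by
  set N : ℕ := ⌊2 / c⌋₊ with hN
  have hMpos : (0 : ℝ) < ((N + 1 : ℕ) : ℝ) ^ D := by positivity
  refine ⟨((N + 1 : ℕ) : ℝ) ^ D, ((N + 1 : ℕ) : ℝ) ^ D, hMpos, hMpos, ?_⟩
  intro xstar ℓ hℓ hℓ1 n Js ks hk hvol hcell
  have hlog : 0 ≤ Real.logb 2 (1 / ℓ) :=
    Real.logb_nonneg (by norm_num) (by rw [le_div_iff₀ hℓ]; linarith)
  have hmem : ∀ i, (WithLp.toLp 2 (fun j => (ks i j : ℝ) / 2 ^ Js i) :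
      EuclideanSpace ℝ (Fin D)) ∈ dyadicCell D (Js i) (ks i) := by
    intro i j
    exact ⟨le_rfl, div_le_div_of_nonneg_right (by linarith) (by positivity)⟩
  have hJ : ∀ i, Js i ≤ ⌊Real.logb 2 (1 / ℓ)⌋₊ := by
    intro i
    have h := (le_max_left _ _).trans (hcell i _ (hmem i))
    rw [zpow_neg, zpow_natCast] at h
    apply Nat.le_floor
    rw [Real.le_logb_iff_rpow_le (by norm_num) (by positivity), Real.rpow_natCast]
    rw [one_div]
    exact (le_inv_comm₀ hℓ (by positivity)).1 h
  have hclose : ∀ i j, |(ks i j : ℝ) - 2 ^ Js i * xstar j| ≤ 1 / c := by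
    intro i j
    have h := (le_max_right _ _).trans (hcell i _ (hmem i))
    rw [zpow_neg, zpow_natCast] at h
    have h2 := PiLp.norm_apply_le ((WithLp.toLp 2 (fun j => (ks i j : ℝ) / 2 ^ Js i) :
      EuclideanSpace ℝ (Fin D)) - xstar) j
    have h3 : |(ks i j : ℝ) / 2 ^ Js i - xstar j| * c ≤ (2 ^ Js i)⁻¹ := by
      refine le_trans ?_ h
      rw [mul_comm]
      exact mul_le_mul_of_nonneg_left h2 hc.le
    have hp : (0 : ℝ) < 2 ^ Js i := by positivity
    have h4 : (ks i j : ℝ) - 2 ^ Js i * xstar j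
        = 2 ^ Js i * ((ks i j : ℝ) / 2 ^ Js i - xstar j) := by
      field_simp
    rw [h4, abs_mul, abs_of_pos hp, le_div_iff₀ hc, mul_assoc]
    calc _ ≤ (2 : ℝ) ^ Js i * (2 ^ Js i)⁻¹ := mul_le_mul_of_nonneg_left h3 hp.le
      _ = 1 := mul_inv_cancel₀ hp.ne'
  let a : ℕ → Fin D → ℤ := fun J j => ⌈(2 : ℝ) ^ J * xstar j - 1 / c⌉
  have ha0 : ∀ i j, a (Js i) j ≤ ks i j := by
    intro i j
    apply Int.ceil_le.2
    have := (abs_le.1 (hclose i j)).1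
    push_cast
    linarith
  have ha1 : ∀ i j, ((ks i j : ℤ) - a (Js i) j).toNat ≤ N := by
    intro i j
    apply Nat.le_floor
    have h1 := (abs_le.1 (hclose i j)).2
    have h2 : (2 : ℝ) ^ Js i * xstar j - 1 / c ≤ (a (Js i) j : ℝ) := Int.le_ceil _
    have h3 : ((((ks i j : ℤ) - a (Js i) j).toNat : ℤ) : ℝ) = (ks i j : ℝ) - a (Js i) j := by
      rw [Int.toNat_of_nonneg (by linarith [ha0 i j])]
      push_cast
      ring
    rw [Int.cast_natCast] at h3
    rw [h3]
    have h4 : 2 / c = 1 / c + 1 / c := by ring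
    linarith
  let Φ : Fin n → ℕ × (Fin D → ℕ) :=
    fun i => (Js i, fun j => ((ks i j : ℤ) - a (Js i) j).toNat)
  have hinj : Function.Injective Φ := by
    intro i i' h
    by_contra hne
    have h1 : Js i = Js i' := congrArg Prod.fst h
    have h2 : ks i = ks i' := by
      funext j
      have h3 : ((ks i j : ℤ) - a (Js i) j).toNat = ((ks i' j : ℤ) - a (Js i') j).toNat :=
        congrFun (congrArg Prod.snd h) j
      have h4 := ha0 i j
      have h5 := ha0 i' j
      rw [← h1] at h3 h5
      omega
    have h3 := hvol i i' hne
    rw [← h1, ← h2, Set.inter_self] at h3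
    exact (dyadicCell_volume_pos D _ _).ne' h3
  have hcard := Finset.card_le_card_of_injOn (s := Finset.univ)
    (t := Finset.range (⌊Real.logb 2 (1 / ℓ)⌋₊ + 1) ×ˢ
      Fintype.piFinset (fun _ : Fin D => Finset.range (N + 1))) Φ
    (by
      intro i _
      simp only [Finset.coe_product, Set.mem_prod, Finset.mem_coe, Finset.mem_range,
        Fintype.mem_piFinset]
      exact ⟨Nat.lt_succ_of_le (hJ i), fun j => Nat.lt_succ_of_le (ha1 i j)⟩)
    hinj.injOn
  rw [Finset.card_product, Fintype.card_piFinset_const, Finset.card_range, Finset.card_range,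
    Finset.card_univ, Fintype.card_fin] at hcard
  have hcard' : (n : ℝ) ≤ ((⌊Real.logb 2 (1 / ℓ)⌋₊ : ℝ) + 1) * ((N + 1 : ℕ) : ℝ) ^ D := by
    exact_mod_cast hcard
  have hfl := Nat.floor_le hlog
  nlinarith [mul_le_mul_of_nonneg_right hfl hMpos.le]
end

section
/- Let D ≥ 1 and R, r, c > 0. There exist constants c₀, c₁ > 0 depending only on D, R, r, c with the following property: for every finite set X⋆ ⊂ [0,1]^D of cardinality S ≥ 1, every integer J ≥ 1, and every cell partition Ω_k of [0,1]^D (a finite family of pairwise non-overlapping dyadic cells whose union is [0,1]^D) such that (i) every cell ω ∈ Ω_k with dist(ω, X⋆) > R has edge-length |ω| ≥ r, (ii) every cell ω ∈ Ω_k with dist(ω, X⋆) ≤ R has edge-length |ω| ≥ c · dist(ω, X⋆), and (iii) min_{ω ∈ Ω_k} |ω| = 2^{-J}, the number of cells satisfies #Ω_k ≤ c₀ + c₁ · S · J. -/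
/-- The distance `dist(A, B) = inf{‖a − b‖₂ : a ∈ A, b ∈ B}` between two sets. -/
noncomputable def setDist {D : ℕ} (A B : Set (EuclideanSpace ℝ (Fin D))) : ℝ :=
  sInf {d : ℝ | ∃ a ∈ A, ∃ b ∈ B, d = dist a b}

lemma dyadicCell_volume_ne_zero (D J : ℕ) (k : Fin D → ℕ) :
    MeasureTheory.volume (dyadicCell D J k) ≠ 0 := by
  have hp : (0 : ℝ) < 2 ^ J := by positivity
  have hopen : IsOpen {y : EuclideanSpace ℝ (Fin D) |
      ∀ i, (k i : ℝ) / 2 ^ J < y i ∧ y i < ((k i : ℝ) + 1) / 2 ^ J} := by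
    have he : {y : EuclideanSpace ℝ (Fin D) |
        ∀ i, (k i : ℝ) / 2 ^ J < y i ∧ y i < ((k i : ℝ) + 1) / 2 ^ J} =
        ⋂ i, ({y : EuclideanSpace ℝ (Fin D) | (k i : ℝ) / 2 ^ J < y i} ∩
          {y : EuclideanSpace ℝ (Fin D) | y i < ((k i : ℝ) + 1) / 2 ^ J}) := by
      ext y
      simp
    rw [he]
    refine isOpen_iInter_of_finite fun i => ?_
    exact (isOpen_lt (by fun_prop) (by fun_prop)).inter (isOpen_lt (by fun_prop) (by fun_prop))
  have hne : {y : EuclideanSpace ℝ (Fin D) |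
      ∀ i, (k i : ℝ) / 2 ^ J < y i ∧ y i < ((k i : ℝ) + 1) / 2 ^ J}.Nonempty := by
    refine ⟨WithLp.toLp 2 (fun i => ((k i : ℝ) + 1 / 2) / 2 ^ J), fun i => ?_⟩
    constructor
    · exact div_lt_div_of_pos_right (by linarith) hp
    · exact div_lt_div_of_pos_right (by linarith) hp
  have h := hopen.measure_pos MeasureTheory.volume hne
  refine (lt_of_lt_of_le h (MeasureTheory.measure_mono ?_)).ne'
  intro y hy i
  exact ⟨(hy i).1.le, (hy i).2.le⟩

lemma dyadicCell_nonempty (D J : ℕ) (k : Fin D → ℕ) : (dyadicCell D J k).Nonempty := by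
  by_contra h
  rw [Set.not_nonempty_iff_eq_empty] at h
  exact dyadicCell_volume_ne_zero D J k (by rw [h]; simp)

/-- A near cell is described by a point of `X`, its level and a bounded offset. -/
lemma near_cell {D J : ℕ} {k : Fin D → ℕ} {c : ℝ} (hc : 0 < c)
    {X : Finset (EuclideanSpace ℝ (Fin D))} (hX : X.Nonempty) {L : ℕ} (hL : 1 / c + 3 ≤ L)
    (h : c * setDist (dyadicCell D J k) ↑X ≤ (2 : ℝ) ^ (-(J : ℤ))) :
    ∃ x ∈ X, ∀ d, (k d : ℤ) - ⌊(2 : ℝ) ^ J * x d⌋ ∈ Finset.Icc (-(L : ℤ)) L := by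
  have hp : (0 : ℝ) < 2 ^ J := by positivity
  rw [zpow_neg, zpow_natCast] at h
  have h1 : setDist (dyadicCell D J k) ↑X < (1 / c + 1) / 2 ^ J := by
    have : setDist (dyadicCell D J k) ↑X ≤ ((2 : ℝ) ^ J)⁻¹ / c := by
      rw [le_div_iff₀ hc]; linarith
    refine this.trans_lt ?_
    rw [add_div, div_div, inv_eq_one_div, div_div, mul_comm]
    have : 0 < 1 / (2 : ℝ) ^ J := by positivity
    linarith
  obtain ⟨a₀, ha₀⟩ := dyadicCell_nonempty D J k
  obtain ⟨x₀, hx₀⟩ := hX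
  have hne : {d : ℝ | ∃ a ∈ dyadicCell D J k, ∃ b ∈ (X : Set (EuclideanSpace ℝ (Fin D))),
      d = dist a b}.Nonempty := ⟨_, a₀, ha₀, x₀, Finset.mem_coe.2 hx₀, rfl⟩
  obtain ⟨_, ⟨a, ha, x, hx, rfl⟩, hlt⟩ :=
    exists_lt_of_csInf_lt hne h1
  refine ⟨x, hx, fun d => ?_⟩
  have h2 : |a d - x d| ≤ dist a x := by
    rw [dist_eq_norm, ← Real.norm_eq_abs]
    exact PiLp.norm_apply_le (a - x) d
  have h3 := h2.trans_lt hlt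
  rw [lt_div_iff₀ hp, ← abs_of_pos hp, ← abs_mul, abs_lt] at h3
  obtain ⟨h4, h5⟩ := ha d
  rw [div_le_iff₀ hp] at h4
  rw [le_div_iff₀ hp] at h5
  have h6 := Int.floor_le ((2 : ℝ) ^ J * x d)
  have h7 := Int.lt_floor_add_one ((2 : ℝ) ^ J * x d)
  rw [Finset.mem_Icc]
  constructor
  · have : (-(L : ℝ)) ≤ (k d : ℝ) - ⌊(2 : ℝ) ^ J * x d⌋ := by nlinarith [h3.1, h3.2]
    exact_mod_cast this
  · have : (k d : ℝ) - ⌊(2 : ℝ) ^ J * x d⌋ ≤ (L : ℝ) := by nlinarith [h3.1, h3.2]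
    exact_mod_cast this

/-- Counting cells of an adaptively refined partition: there are constants `c₀, c₁ > 0`
depending only on `D, R, r, c` such that any cell partition of `[0,1]^D` whose cells
far from `X⋆` (distance `> R`) have edge-length `≥ r`, whose cells near `X⋆`
(distance `≤ R`) have edge-length `≥ c·dist(ω, X⋆)`, and whose minimal edge-length is
`2^{-J}`, has at most `c₀ + c₁·S·J` cells, where `S = #X⋆`. -/
theorem card_partition_le (D : ℕ) (hD : 1 ≤ D) (R r c : ℝ)
    (hR : 0 < R) (hr : 0 < r) (hc : 0 < c) :
    ∃ c₀ c₁ : ℝ, 0 < c₀ ∧ 0 < c₁ ∧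
      ∀ (Xstar : Finset (EuclideanSpace ℝ (Fin D))), 1 ≤ Xstar.card →
      ∀ (J : ℕ), 1 ≤ J →
      ∀ (n : ℕ) (Js : Fin n → ℕ) (ks : Fin n → Fin D → ℕ),
        (∀ i j, ks i j < 2 ^ Js i) →
        (∀ i i', i ≠ i' →
          MeasureTheory.volume
            (dyadicCell D (Js i) (ks i) ∩ dyadicCell D (Js i') (ks i')) = 0) →
        (⋃ i, dyadicCell D (Js i) (ks i)) =
          {y : EuclideanSpace ℝ (Fin D) | ∀ j, 0 ≤ y j ∧ y j ≤ 1} →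
        (∀ i, R < setDist (dyadicCell D (Js i) (ks i)) ↑Xstar →
          r ≤ (2 : ℝ) ^ (-(Js i : ℤ))) →
        (∀ i, setDist (dyadicCell D (Js i) (ks i)) ↑Xstar ≤ R →
          c * setDist (dyadicCell D (Js i) (ks i)) ↑Xstar ≤ (2 : ℝ) ^ (-(Js i : ℤ))) →
        (∀ i, Js i ≤ J) → (∃ i, Js i = J) →
        (n : ℝ) ≤ c₀ + c₁ * Xstar.card * J := by
  classical
  obtain ⟨M, hM⟩ := exists_pow_lt_of_lt_one hr (by norm_num : (1 / 2 : ℝ) < 1)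
  obtain ⟨L, hL⟩ := exists_nat_ge (1 / c + 3)
  refine ⟨((M + 1) * (2 ^ M) ^ D : ℕ), (2 * (2 * L + 1) ^ D : ℕ), by positivity, by positivity, ?_⟩
  intro X hX J hJ n Js ks hks hov _ hfar hnear hJs _
  have hXne : X.Nonempty := Finset.card_pos.1 hX
  have hinj : ∀ i i', Js i = Js i' → ks i = ks i' → i = i' := by
    intro i i' h1 h2
    by_contra hne
    have := hov i i' hne
    rw [h1, h2, Set.inter_self] at this
    exact dyadicCell_volume_ne_zero _ _ _ this
  let P : Fin n → Prop := fun i => R < setDist (dyadicCell D (Js i) (ks i)) ↑X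
  have hA : (Finset.univ.filter P).card ≤ (M + 1) * (2 ^ M) ^ D := by
    have : (Finset.univ.filter P).card ≤
        (Finset.range (M + 1) ×ˢ
          Fintype.piFinset (fun _ : Fin D => Finset.range (2 ^ M))).card := by
      refine Finset.card_le_card_of_injOn (fun i => (Js i, ks i)) ?_ ?_
      · intro i hi
        have hi' : P i := (Finset.mem_filter.1 (Finset.mem_coe.1 hi)).2
        have h1 := hfar i hi'
        rw [zpow_neg, zpow_natCast, ← inv_pow, ← one_div] at h1
        have h2 : Js i < M := by
          by_contra hcon
          have := pow_le_pow_of_le_one (by norm_num : (0 : ℝ) ≤ 1 / 2) (by norm_num)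
            (not_lt.1 hcon)
          linarith
        simp only [Finset.mem_coe, Finset.mem_product, Finset.mem_range, Fintype.mem_piFinset]
        exact ⟨by omega, fun d => (hks i d).trans_le (Nat.pow_le_pow_right (by norm_num) h2.le)⟩
      · intro i _ i' _ h
        simp only [Prod.mk.injEq] at h
        exact hinj i i' h.1 h.2
    simpa [Finset.card_product, Fintype.card_piFinset] using this
  have hB : (Finset.univ.filter (fun i => ¬ P i)).card ≤
      X.card * ((J + 1) * (2 * L + 1) ^ D) := by
    have hex : ∀ i, ∃ x, ¬ P i → x ∈ X ∧ ∀ d,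
        (ks i d : ℤ) - ⌊(2 : ℝ) ^ (Js i) * x d⌋ ∈ Finset.Icc (-(L : ℤ)) L := by
      intro i
      by_cases hi : P i
      · exact ⟨0, fun h => absurd hi h⟩
      · obtain ⟨x, hx, h⟩ := near_cell hc hXne hL (hnear i (not_lt.1 hi))
        exact ⟨x, fun _ => ⟨hx, h⟩⟩
    choose f hf using hex
    have : (Finset.univ.filter (fun i => ¬ P i)).card ≤
        (X ×ˢ (Finset.range (J + 1) ×ˢ
          Fintype.piFinset (fun _ : Fin D => Finset.Icc (-(L : ℤ)) L))).card := by
      refine Finset.card_le_card_of_injOn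
        (fun i => (f i, Js i, fun d => (ks i d : ℤ) - ⌊(2 : ℝ) ^ (Js i) * f i d⌋)) ?_ ?_
      · intro i hi
        have hi' : ¬ P i := (Finset.mem_filter.1 (Finset.mem_coe.1 hi)).2
        have := hf i hi'
        have hJi := hJs i
        rw [Finset.mem_coe, Finset.mem_product, Finset.mem_product, Fintype.mem_piFinset,
          Finset.mem_range]
        exact ⟨this.1, Nat.lt_succ_of_le hJi, this.2⟩
      · intro i _ i' _ h
        simp only [Prod.mk.injEq] at h
        obtain ⟨h1, h2, h3⟩ := h
        refine hinj i i' h2 (funext fun d => ?_)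
        have := congrFun h3 d
        simp only [h1, h2] at this
        omega
    have hcard : (Finset.Icc (-(L : ℤ)) L).card = 2 * L + 1 := by
      rw [Int.card_Icc]; omega
    simpa only [Finset.card_product, Fintype.card_piFinset, Finset.card_range, hcard,
      Finset.prod_const, Finset.card_univ, Fintype.card_fin] using this
  have hn : n ≤ (M + 1) * (2 ^ M) ^ D + (2 * (2 * L + 1) ^ D) * X.card * J := by
    have h := Finset.card_filter_add_card_filter_not (s := (Finset.univ : Finset (Fin n))) P
    rw [Finset.card_univ, Fintype.card_fin] at h
    have h2 : X.card * ((J + 1) * (2 * L + 1) ^ D) ≤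
        X.card * ((2 * J) * (2 * L + 1) ^ D) := by
      gcongr
      omega
    have h3 : X.card * ((2 * J) * (2 * L + 1) ^ D) = (2 * (2 * L + 1) ^ D) * X.card * J := by
      ring
    omega
  exact_mod_cast hn
end
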